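/- arXiv:2605.30439 — 5 statements merged into one kernel-verified Lean document; each statement's English description precedes it below -/
import Mathlib

section
/- Let R be a commutative ring and q ∈ R. Let M₊(q) be the 6×6 matrix over R with rows (0, 4q, 0, 0, 32q², 0), (1, 0, 6q, 2q, 0, 16q²), (0, 1, 0, 0, 6q, 0), (0, 2, 0, 0, 4q, 0), (0, 0, 1, 1, 0, 2q), (0, 0, 0, 0, 2, 0). Then the characteristic polynomial of 2·M₊(q) equals X²·(X² − 128q)·(X² + 16q) in R[X]. -/
open Polynomial

def Mplus (R : Type*) [CommRing R] (q : R) : Matrix (Fin 6) (Fin 6) R :=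
  !![0, 4*q, 0, 0, 32*q^2, 0;
     1, 0, 6*q, 2*q, 0, 16*q^2;
     0, 1, 0, 0, 6*q, 0;
     0, 2, 0, 0, 4*q, 0;
     0, 0, 1, 1, 0, 2*q;
     0, 0, 0, 0, 2, 0]

theorem charpoly_two_smul_Mplus (R : Type*) [CommRing R] (q : R) :
    ((2 : R) • Mplus R q).charpoly
      = X ^ 2 * (X ^ 2 - C (128 * q)) * (X ^ 2 + C (16 * q)) := by
  have h : ((2 : R) • Mplus R q).charmatrix =
      !![X, -(8 * C q), 0, 0, -(64 * C q ^ 2), 0;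
        -2, X, -(12 * C q), -(4 * C q), 0, -(32 * C q ^ 2);
        0, -2, X, 0, -(12 * C q), 0;
        0, -4, 0, X, -(8 * C q), 0;
        0, 0, -2, -2, X, -(4 * C q);
        0, 0, 0, 0, -4, X] := by
    have c2 : (C (2 : R)) = 2 := rfl
    have c4 : (C (4 : R)) = 4 := rfl
    have c6 : (C (6 : R)) = 6 := rfl
    have c16 : (C (16 : R)) = 16 := rfl
    have c32 : (C (32 : R)) = 32 := rfl
    ext1 i j
    fin_cases i <;> fin_cases j <;>
      simp [Matrix.charmatrix_apply, Mplus, c2, c4, c6, c16, c32] <;> ring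
  have c16 : (C (16 : R)) = 16 := rfl
  have c128 : (C (128 : R)) = 128 := rfl
  rw [Matrix.charpoly, h, C_mul, C_mul, c16, c128]
  generalize C q = t
  generalize (X : R[X]) = x
  simp [Matrix.det_succ_row_zero, Fin.sum_univ_succ, Fin.succAbove]
  ring
end

section
/- Let f₀ ∈ ℚ[x₀, x₁, x₂, y₀, y₁, y₂] be the bidegree-(2,2) polynomial f₀ = Σ_{i,j=1}^{6} A_{ij} Q_{x,i} Q_{y,j}, where Qₓ = (x₀², x₀x₁, x₀x₂, x₁², x₁x₂, x₂²), Q_y = (y₀², y₀y₁, y₀y₂, y₁², y₁y₂, y₂²), and A is the symmetric 6×6 integer matrix with rows (1,1,−2,0,2,1), (1,1,0,1,0,2), (−2,0,−1,2,−1,0), (0,1,2,−1,−2,2), (2,0,−1,−2,0,2), (1,2,0,2,2,2). For 0 ≤ i, j ≤ 2 define g_{ij} = x_j·(∂f₀/∂xᵢ) + y_j·(∂f₀/∂yᵢ). Then the nine polynomials g_{ij} are linearly independent over ℚ. -/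
open MvPolynomial

noncomputable section

/-- The variable `xᵢ`. -/
def xv (i : Fin 3) : MvPolynomial (Fin 3 ⊕ Fin 3) ℚ := X (Sum.inl i)

/-- The variable `yᵢ`. -/
def yv (i : Fin 3) : MvPolynomial (Fin 3 ⊕ Fin 3) ℚ := X (Sum.inr i)

/-- The quadratic monomials in the `x` variables. -/
def Qx : Fin 6 → MvPolynomial (Fin 3 ⊕ Fin 3) ℚ :=
  ![xv 0 ^ 2, xv 0 * xv 1, xv 0 * xv 2, xv 1 ^ 2, xv 1 * xv 2, xv 2 ^ 2]

/-- The quadratic monomials in the `y` variables. -/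
def Qy : Fin 6 → MvPolynomial (Fin 3 ⊕ Fin 3) ℚ :=
  ![yv 0 ^ 2, yv 0 * yv 1, yv 0 * yv 2, yv 1 ^ 2, yv 1 * yv 2, yv 2 ^ 2]

/-- The coefficient matrix. -/
def A : Matrix (Fin 6) (Fin 6) ℚ :=
  !![ 1,  1, -2,  0,  2,  1;
      1,  1,  0,  1,  0,  2;
     -2,  0, -1,  2, -1,  0;
      0,  1,  2, -1, -2,  2;
      2,  0, -1, -2,  0,  2;
      1,  2,  0,  2,  2,  2]

/-- The symmetric branch polynomial `f₀`. -/
def f0 : MvPolynomial (Fin 3 ⊕ Fin 3) ℚ :=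
  ∑ i : Fin 6, ∑ j : Fin 6, C (A i j) * Qx i * Qy j

/-- The invariant infinitesimal diagonal `GL₃`-orbit generators. -/
def g (i j : Fin 3) : MvPolynomial (Fin 3 ⊕ Fin 3) ℚ :=
  xv j * pderiv (Sum.inl i) f0 + yv j * pderiv (Sum.inr i) f0

/-- Evaluation of a vanishing combination of the `g i j` at a point. -/
theorem eval_comb (c : Fin 3 × Fin 3 → ℚ) (h : ∑ p, c p • g p.1 p.2 = 0)
    (a b : Fin 3 → ℚ) : ∑ p : Fin 3 × Fin 3, c p * eval (Sum.elim a b) (g p.1 p.2) = 0 := by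
  have := congrArg (eval (Sum.elim a b)) h
  simpa [map_sum, smul_eval] using this

theorem gij_linearIndependent :
    LinearIndependent ℚ (fun p : Fin 3 × Fin 3 => g p.1 p.2) := by
  rw [Fintype.linearIndependent_iff]
  intro c h
  have key := eval_comb c h
  simp only [Fintype.sum_prod_type, Fin.sum_univ_three] at key
  simp [g, f0, Fin.sum_univ_six, A, Qx, Qy, xv, yv, pderiv_X, Pi.single_apply] at key
  have h0 := key ![0, 0, 1] ![0, 0, 1]
  have h1 := key ![0, 0, 1] ![0, 1, 0]
  have h2 := key ![0, 0, 1] ![1, 0, 0]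
  have h3 := key ![0, 1, 0] ![0, 1, 0]
  have h4 := key ![0, 1, 0] ![1, 0, 0]
  have h5 := key ![1, 0, 0] ![1, 0, 0]
  have h6 := key ![0, 0, 1] ![0, 1, 1]
  have h7 := key ![0, 0, 1] ![1, 0, 1]
  have h8 := key ![0, 0, 1] ![1, 1, 0]
  clear key
  simp at h0 h1 h2 h3 h4 h5 h6 h7 h8
  ring_nf at h0 h1 h2 h3 h4 h5 h6 h7 h8
  rintro ⟨i, j⟩
  fin_cases i <;> fin_cases j <;> simp <;> linarith

end
end

section
/- Let f₀ ∈ ℚ[x₀, x₁, x₂, y₀, y₁, y₂] be the bidegree-(2,2) polynomial f₀ = Σ_{i,j=1}^{6} A_{ij} Q_{x,i} Q_{y,j}, where Qₓ = (x₀², x₀x₁, x₀x₂, x₁², x₁x₂, x₂²), Q_y = (y₀², y₀y₁, y₀y₂, y₁², y₁y₂, y₂²), and A is the symmetric 6×6 integer matrix with rows (1,1,−2,0,2,1), (1,1,0,1,0,2), (−2,0,−1,2,−1,0), (0,1,2,−1,−2,2), (2,0,−1,−2,0,2), (1,2,0,2,2,2). Then the ℚ-linear span of the eighteen polynomials x_j·(∂f₀/∂xᵢ)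 and y_j·(∂f₀/∂yᵢ), for 0 ≤ i, j ≤ 2, has dimension 17. -/
open MvPolynomial

noncomputable section

/-- The eighteen degree-(2,2) Jacobian generators `x_j ∂f₀/∂xᵢ` and `y_j ∂f₀/∂yᵢ`. -/
def jacGen : (Fin 3 × Fin 3) ⊕ (Fin 3 × Fin 3) → MvPolynomial (Fin 3 ⊕ Fin 3) ℚ :=
  Sum.elim (fun p => xv p.2 * pderiv (Sum.inl p.1) f0)
           (fun p => yv p.2 * pderiv (Sum.inr p.1) f0)


/-- The first seventeen of the eighteen generators. -/
def jacIdx : Fin 17 → (Fin 3 × Fin 3) ⊕ (Fin 3 × Fin 3) :=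
  ![.inl (0, 0), .inl (0, 1), .inl (0, 2), .inl (1, 0), .inl (1, 1), .inl (1, 2), .inl (2, 0), .inl (2, 1), .inl (2, 2), .inr (0, 0), .inr (0, 1), .inr (0, 2), .inr (1, 0), .inr (1, 1), .inr (1, 2), .inr (2, 0), .inr (2, 1)]

/-- The general point with coordinates `a b c` (in `x`) and `d e f` (in `y`). -/
def pt (x y : Fin 3 → ℚ) : Fin 3 ⊕ Fin 3 → ℚ := Sum.elim x y

/-- The monomial values at a point. -/
def qv (x : Fin 3 → ℚ) : Fin 6 → ℚ :=
  ![x 0 ^ 2, x 0 * x 1, x 0 * x 2, x 1 ^ 2, x 1 * x 2, x 2 ^ 2]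

/-- The partial derivatives of the monomials at a point. -/
def dqv (x : Fin 3 → ℚ) : Fin 3 → Fin 6 → ℚ :=
  ![![2 * x 0, x 1, x 2, 0, 0, 0], ![0, x 0, 0, 2 * x 1, x 2, 0], ![0, 0, x 0, 0, x 1, 2 * x 2]]

lemma eval_Qx (x y : Fin 3 → ℚ) (i : Fin 6) : eval (pt x y) (Qx i) = qv x i := by
  fin_cases i <;> simp [Qx, qv, pt, xv]

lemma eval_Qy (x y : Fin 3 → ℚ) (i : Fin 6) : eval (pt x y) (Qy i) = qv y i := by
  fin_cases i <;> simp [Qy, qv, pt, yv]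

lemma eval_dQx (x y : Fin 3 → ℚ) (k : Fin 3) (i : Fin 6) :
    eval (pt x y) (pderiv (Sum.inl k) (Qx i)) = dqv x k i := by
  fin_cases k <;> fin_cases i <;>
    simp [Qx, dqv, pt, xv, pderiv_X, Pi.single_apply, Derivation.leibniz, Derivation.leibniz_pow]

lemma eval_dQy (x y : Fin 3 → ℚ) (k : Fin 3) (i : Fin 6) :
    eval (pt x y) (pderiv (Sum.inr k) (Qy i)) = dqv y k i := by
  fin_cases k <;> fin_cases i <;>
    simp [Qy, dqv, pt, yv, pderiv_X, Pi.single_apply, Derivation.leibniz, Derivation.leibniz_pow]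

lemma dxQy (k : Fin 3) (i : Fin 6) : pderiv (Sum.inl k) (Qy i) = 0 := by
  fin_cases i <;> simp [Qy, yv, pderiv_X, Derivation.leibniz, Derivation.leibniz_pow]

lemma dyQx (k : Fin 3) (i : Fin 6) : pderiv (Sum.inr k) (Qx i) = 0 := by
  fin_cases i <;> simp [Qx, xv, pderiv_X, Derivation.leibniz, Derivation.leibniz_pow]

lemma eval_gx (x y : Fin 3 → ℚ) (i j : Fin 3) :
    eval (pt x y) (jacGen (.inl (i, j))) =
      x j * ∑ k : Fin 6, ∑ l : Fin 6, A k l * dqv x i k * qv y l := by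
  simp only [jacGen, Sum.elim_inl, f0, map_sum, map_mul, Derivation.leibniz, dxQy, pderiv_C, map_add,
    smul_eq_mul, eval_dQx, eval_Qx, eval_Qy, eval_C, mul_zero, map_zero, zero_add, add_zero]
  congr 1
  · simp [xv, pt]
  · exact Finset.sum_congr rfl fun k _ => Finset.sum_congr rfl fun l _ => by ring

lemma eval_gy (x y : Fin 3 → ℚ) (i j : Fin 3) :
    eval (pt x y) (jacGen (.inr (i, j))) =
      y j * ∑ k : Fin 6, ∑ l : Fin 6, A k l * qv x k * dqv y i l := by
  simp only [jacGen, Sum.elim_inr, f0, map_sum, map_mul, Derivation.leibniz, dyQx, pderiv_C, map_add,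
    smul_eq_mul, eval_dQy, eval_Qx, eval_Qy, eval_C, mul_zero, map_zero, zero_add, add_zero]
  congr 1
  · simp [yv, pt]

/-- Euler relation between the generators. -/
lemma euler_Qx (i : Fin 6) : ∑ k : Fin 3, xv k * pderiv (Sum.inl k) (Qx i) = 2 * Qx i := by
  fin_cases i <;>
    simp [Fin.sum_univ_three, Qx, xv, pderiv_X, Pi.single_apply, Derivation.leibniz,
      Derivation.leibniz_pow] <;> ring

lemma euler_Qy (i : Fin 6) : ∑ k : Fin 3, yv k * pderiv (Sum.inr k) (Qy i) = 2 * Qy i := by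
  fin_cases i <;>
    simp [Fin.sum_univ_three, Qy, yv, pderiv_X, Pi.single_apply, Derivation.leibniz,
      Derivation.leibniz_pow] <;> ring

lemma euler_x : ∑ k : Fin 3, jacGen (.inl (k, k)) = 2 * f0 := by
  simp only [jacGen, Sum.elim_inl, f0, map_sum, Derivation.leibniz, dxQy, pderiv_C,
    smul_eq_mul, mul_zero, zero_add, add_zero, Finset.mul_sum]
  rw [Finset.sum_comm]
  refine Finset.sum_congr rfl fun i _ => ?_
  rw [Finset.sum_comm]
  refine Finset.sum_congr rfl fun j _ => ?_
  have h := euler_Qx i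
  simp only [Fin.sum_univ_three] at h ⊢
  linear_combination (C (A i j) * Qy j) * h

lemma euler_y : ∑ k : Fin 3, jacGen (.inr (k, k)) = 2 * f0 := by
  simp only [jacGen, Sum.elim_inr, f0, map_sum, Derivation.leibniz, dyQx, pderiv_C,
    smul_eq_mul, mul_zero, zero_add, add_zero, Finset.mul_sum]
  rw [Finset.sum_comm]
  refine Finset.sum_congr rfl fun i _ => ?_
  rw [Finset.sum_comm]
  refine Finset.sum_congr rfl fun j _ => ?_
  have h := euler_Qy j
  simp only [Fin.sum_univ_three] at h ⊢
  linear_combination (C (A i j) * Qx i) * h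

lemma span_eq : Submodule.span ℚ (Set.range jacGen) =
    Submodule.span ℚ (Set.range (jacGen ∘ jacIdx)) := by
  apply le_antisymm
  · rw [Submodule.span_le]
    have key : ∀ n, jacGen (jacIdx n) ∈ Submodule.span ℚ (Set.range (jacGen ∘ jacIdx)) :=
      fun n => Submodule.subset_span ⟨n, rfl⟩
    have hrel : jacGen (.inr (2, 2)) = jacGen (jacIdx 0) + jacGen (jacIdx 4) + jacGen (jacIdx 8)
        - jacGen (jacIdx 9) - jacGen (jacIdx 13) := by
      have h := euler_x.trans euler_y.symm
      simp only [Fin.sum_univ_three] at h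
      change _ = jacGen (.inl (0, 0)) + jacGen (.inl (1, 1)) + jacGen (.inl (2, 2))
        - jacGen (.inr (0, 0)) - jacGen (.inr (1, 1))
      linear_combination -h
    rintro _ ⟨s, rfl⟩
    rcases s with ⟨i, j⟩ | ⟨i, j⟩
    · fin_cases i <;> fin_cases j
      · exact key 0
      · exact key 1
      · exact key 2
      · exact key 3
      · exact key 4
      · exact key 5
      · exact key 6
      · exact key 7
      · exact key 8
    · fin_cases i <;> fin_cases j
      · exact key 9
      · exact key 10
      · exact key 11
      · exact key 12
      · exact key 13
      · exact key 14
      · exact key 15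
      · exact key 16
      · change jacGen (.inr (2, 2)) ∈ _
        rw [hrel]
        exact sub_mem (sub_mem (add_mem (add_mem (key 0) (key 4)) (key 8)) (key 9)) (key 13)
  · exact Submodule.span_mono (Set.range_comp_subset_range _ _)

/-- Evaluation of a linear combination of the generators at a point. -/
lemma eval_comb_s7 (c : Fin 17 → ℚ) (h : ∑ n, c n • (jacGen ∘ jacIdx) n = 0) (x y : Fin 3 → ℚ) :
    ∑ n, c n * eval (pt x y) (jacGen (jacIdx n)) = 0 := by
  have h2 := congrArg (eval (pt x y)) h
  simpa [map_sum, smul_eval] using h2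

lemma row0 (c : Fin 17 → ℚ) (h : ∑ n, c n • (jacGen ∘ jacIdx) n = 0) :
    (2) * c 5 + (4) * c 8 + (2) * c 14 = 0 := by
  have h2 := eval_comb_s7 c h ![0, 0, 1] ![0, 0, 1]
  simp [Fin.sum_univ_succ, jacIdx, eval_gx, eval_gy, A, qv, dqv] at h2
  linear_combination h2

lemma row1 (c : Fin 17 → ℚ) (h : ∑ n, c n • (jacGen ∘ jacIdx) n = 0) :
    (2) * c 2 + (-2) * c 5 + (4) * c 8 + (2) * c 10 + (4) * c 13 + (2) * c 16 = 0 := by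
  have h2 := eval_comb_s7 c h ![0, 0, 1] ![0, 1, 0]
  simp [Fin.sum_univ_succ, jacIdx, eval_gx, eval_gy, A, qv, dqv] at h2
  linear_combination h2

lemma row2 (c : Fin 17 → ℚ) (h : ∑ n, c n • (jacGen ∘ jacIdx) n = 0) :
    (-2) * c 2 + (2) * c 5 + (2) * c 8 + (2) * c 9 + (2) * c 12 = 0 := by
  have h2 := eval_comb_s7 c h ![0, 0, 1] ![1, 0, 0]
  simp [Fin.sum_univ_succ, jacIdx, eval_gx, eval_gy, A, qv, dqv] at h2
  linear_combination h2

lemma row3 (c : Fin 17 → ℚ) (h : ∑ n, c n • (jacGen ∘ jacIdx) n = 0) :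
    (2) * c 1 + (4) * c 4 + (2) * c 7 + (2) * c 11 + (-2) * c 14 = 0 := by
  have h2 := eval_comb_s7 c h ![0, 1, 0] ![0, 0, 1]
  simp [Fin.sum_univ_succ, jacIdx, eval_gx, eval_gy, A, qv, dqv] at h2
  linear_combination h2

lemma row4 (c : Fin 17 → ℚ) (h : ∑ n, c n • (jacGen ∘ jacIdx) n = 0) :
    (1) * c 1 + (-2) * c 4 + (-2) * c 7 + (1) * c 10 + (-2) * c 13 + (-2) * c 16 = 0 := by
  have h2 := eval_comb_s7 c h ![0, 1, 0] ![0, 1, 0]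
  simp [Fin.sum_univ_succ, jacIdx, eval_gx, eval_gy, A, qv, dqv] at h2
  linear_combination h2

lemma row5 (c : Fin 17 → ℚ) (h : ∑ n, c n • (jacGen ∘ jacIdx) n = 0) :
    (1) * c 1 + (2) * c 7 + (1) * c 12 + (2) * c 15 = 0 := by
  have h2 := eval_comb_s7 c h ![0, 1, 0] ![1, 0, 0]
  simp [Fin.sum_univ_succ, jacIdx, eval_gx, eval_gy, A, qv, dqv] at h2
  linear_combination h2

lemma row6 (c : Fin 17 → ℚ) (h : ∑ n, c n • (jacGen ∘ jacIdx) n = 0) :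
    (2) * c 0 + (2) * c 3 + (-2) * c 11 + (2) * c 14 = 0 := by
  have h2 := eval_comb_s7 c h ![1, 0, 0] ![0, 0, 1]
  simp [Fin.sum_univ_succ, jacIdx, eval_gx, eval_gy, A, qv, dqv] at h2
  linear_combination h2

lemma row7 (c : Fin 17 → ℚ) (h : ∑ n, c n • (jacGen ∘ jacIdx) n = 0) :
    (1) * c 3 + (2) * c 6 + (1) * c 10 + (2) * c 16 = 0 := by
  have h2 := eval_comb_s7 c h ![1, 0, 0] ![0, 1, 0]
  simp [Fin.sum_univ_succ, jacIdx, eval_gx, eval_gy, A, qv, dqv] at h2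
  linear_combination h2

lemma row8 (c : Fin 17 → ℚ) (h : ∑ n, c n • (jacGen ∘ jacIdx) n = 0) :
    (2) * c 0 + (1) * c 3 + (-2) * c 6 + (2) * c 9 + (1) * c 12 + (-2) * c 15 = 0 := by
  have h2 := eval_comb_s7 c h ![1, 0, 0] ![1, 0, 0]
  simp [Fin.sum_univ_succ, jacIdx, eval_gx, eval_gy, A, qv, dqv] at h2
  linear_combination h2

lemma row9 (c : Fin 17 → ℚ) (h : ∑ n, c n • (jacGen ∘ jacIdx) n = 0) :
    (1) * c 2 + (12) * c 8 + (2) * c 10 + (2) * c 11 + (6) * c 13 + (6) * c 14 + (6) * c 16 = 0 := by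
  have h2 := eval_comb_s7 c h ![0, 0, 1] ![0, 1, 1]
  simp [Fin.sum_univ_succ, jacIdx, eval_gx, eval_gy, A, qv, dqv] at h2
  linear_combination h2

lemma row10 (c : Fin 17 → ℚ) (h : ∑ n, c n • (jacGen ∘ jacIdx) n = 0) :
    (-3) * c 2 + (3) * c 5 + (6) * c 8 + (2) * c 9 + (2) * c 11 + (4) * c 12 + (4) * c 14 + (4) * c 15 = 0 := by
  have h2 := eval_comb_s7 c h ![0, 0, 1] ![1, 0, 1]
  simp [Fin.sum_univ_succ, jacIdx, eval_gx, eval_gy, A, qv, dqv] at h2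
  linear_combination h2

lemma row11 (c : Fin 17 → ℚ) (h : ∑ n, c n • (jacGen ∘ jacIdx) n = 0) :
    (10) * c 8 + (4) * c 9 + (4) * c 10 + (6) * c 12 + (6) * c 13 + (2) * c 15 + (2) * c 16 = 0 := by
  have h2 := eval_comb_s7 c h ![0, 0, 1] ![1, 1, 0]
  simp [Fin.sum_univ_succ, jacIdx, eval_gx, eval_gy, A, qv, dqv] at h2
  linear_combination h2

lemma row12 (c : Fin 17 → ℚ) (h : ∑ n, c n • (jacGen ∘ jacIdx) n = 0) :
    (3) * c 1 + (-2) * c 4 + (3) * c 10 + (3) * c 11 + (-4) * c 13 + (-4) * c 14 + (2) * c 16 = 0 := by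
  have h2 := eval_comb_s7 c h ![0, 1, 0] ![0, 1, 1]
  simp [Fin.sum_univ_succ, jacIdx, eval_gx, eval_gy, A, qv, dqv] at h2
  linear_combination h2

lemma row13 (c : Fin 17 → ℚ) (h : ∑ n, c n • (jacGen ∘ jacIdx) n = 0) :
    (3) * c 1 + (8) * c 4 + (3) * c 7 + (2) * c 9 + (2) * c 11 + (-1) * c 12 + (-1) * c 14 + (6) * c 15 = 0 := by
  have h2 := eval_comb_s7 c h ![0, 1, 0] ![1, 0, 1]
  simp [Fin.sum_univ_succ, jacIdx, eval_gx, eval_gy, A, qv, dqv] at h2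
  linear_combination h2

lemma row14 (c : Fin 17 → ℚ) (h : ∑ n, c n • (jacGen ∘ jacIdx) n = 0) :
    (3) * c 1 + (1) * c 9 + (1) * c 10 + (-1) * c 12 + (-1) * c 13 = 0 := by
  have h2 := eval_comb_s7 c h ![0, 1, 0] ![1, 1, 0]
  simp [Fin.sum_univ_succ, jacIdx, eval_gx, eval_gy, A, qv, dqv] at h2
  linear_combination h2

lemma row15 (c : Fin 17 → ℚ) (h : ∑ n, c n • (jacGen ∘ jacIdx) n = 0) :
    (6) * c 0 + (3) * c 3 + (1) * c 6 + (-1) * c 10 + (-1) * c 11 + (2) * c 13 + (2) * c 14 + (4) * c 16 = 0 := by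
  have h2 := eval_comb_s7 c h ![1, 0, 0] ![0, 1, 1]
  simp [Fin.sum_univ_succ, jacIdx, eval_gx, eval_gy, A, qv, dqv] at h2
  linear_combination h2

lemma row16 (c : Fin 17 → ℚ) (h : ∑ n, c n • (jacGen ∘ jacIdx) n = 0) :
    (3) * c 3 + (-3) * c 6 + (3) * c 12 + (3) * c 14 = 0 := by
  have h2 := eval_comb_s7 c h ![1, 0, 0] ![1, 0, 1]
  simp [Fin.sum_univ_succ, jacIdx, eval_gx, eval_gy, A, qv, dqv] at h2
  linear_combination h2

lemma jac_li : LinearIndependent ℚ (jacGen ∘ jacIdx) := by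
  rw [Fintype.linearIndependent_iff]
  intro c h
  have h0 := row0 c h
  have h1 := row1 c h
  have h2 := row2 c h
  have h3 := row3 c h
  have h4 := row4 c h
  have h5 := row5 c h
  have h6 := row6 c h
  have h7 := row7 c h
  have h8 := row8 c h
  have h9 := row9 c h
  have h10 := row10 c h
  have h11 := row11 c h
  have h12 := row12 c h
  have h13 := row13 c h
  have h14 := row14 c h
  have h15 := row15 c h
  have h16 := row16 c h
  intro n
  fin_cases n
  · change c 0 = 0
    linear_combination (32179/80718) * h0 + (10561/13453) * h1 + (-53342/40359) * h2 + (12629/80718) * h3 + (-63851/40359) * h4 + (-15079/13453) * h5 + (3277/7338) * h6 + (-4475/13453) * h7 + (-580/40359) * h8 + (-32179/40359) * h9 + (15319/13453) * h10 + (2600/40359) * h11 + (10004/40359) * h12 + (-16619/40359) * h13 + (38768/40359) * h14 + (304/13453) * h15 + (-24778/121077) * h16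
  · change c 1 = 0
    linear_combination (-3422/13453) * h0 + (-10864/13453) * h1 + (7498/13453) * h2 + (1567/26906) * h3 + (13132/13453) * h4 + (8852/13453) * h5 + (-405/1223) * h6 + (-641/13453) * h7 + (-2097/13453) * h8 + (6844/13453) * h9 + (-9960/13453) * h10 + (1978/13453) * h11 + (-2241/13453) * h12 + (2331/13453) * h13 + (-3456/13453) * h14 + (2184/13453) * h15 + (5096/40359) * h16
  · change c 2 = 0
    linear_combination (22679/80718) * h0 + (-14408/13453) * h1 + (-2701/40359) * h2 + (-7765/40359) * h3 + (41291/40359) * h4 + (10432/13453) * h5 + (-2756/3669) * h6 + (4965/13453) * h7 + (10489/40359) * h8 + (17680/40359) * h9 + (-11525/13453) * h10 + (12823/40359) * h11 + (-9461/40359) * h12 + (11840/40359) * h13 + (-21398/40359) * h14 + (2203/13453) * h15 + (15421/121077) * h16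
  · change c 3 = 0
    linear_combination (-24401/80718) * h0 + (5359/13453) * h1 + (87169/40359) * h2 + (-3925/80718) * h3 + (82123/40359) * h4 + (18671/13453) * h5 + (-1462/3669) * h6 + (7990/13453) * h7 + (8927/40359) * h8 + (24401/40359) * h9 + (-13087/13453) * h10 + (-24709/40359) * h11 + (-11188/40359) * h12 + (18715/40359) * h13 + (-52264/40359) * h14 + (795/13453) * h15 + (32471/121077) * h16
  · change c 4 = 0
    linear_combination (-1927/40359) * h0 + (-9362/13453) * h1 + (-20435/40359) * h2 + (4174/40359) * h3 + (-18367/80718) * h4 + (-10025/26906) * h5 + (1561/7338) * h6 + (-4151/26906) * h7 + (-11105/80718) * h8 + (3854/40359) * h9 + (-1272/13453) * h10 + (13757/40359) * h11 + (1832/40359) * h12 + (1120/40359) * h13 + (2339/40359) * h14 + (-337/13453) * h15 + (-2359/121077) * h16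
  · change c 5 = 0
    linear_combination (140039/80718) * h0 + (43004/13453) * h1 + (-100918/40359) * h2 + (3968/40359) * h3 + (-175639/40359) * h4 + (-39458/13453) * h5 + (1294/3669) * h6 + (-4313/13453) * h7 + (-12569/40359) * h8 + (-99680/40359) * h9 + (40020/13453) * h10 + (-11849/40359) * h11 + (20287/40359) * h12 + (-40822/40359) * h13 + (115894/40359) * h14 + (-185/13453) * h15 + (-1295/121077) * h16
  · change c 6 = 0
    linear_combination (-11971/40359) * h0 + (-10721/13453) * h1 + (25420/40359) * h2 + (3478/40359) * h3 + (55555/40359) * h4 + (12812/13453) * h5 + (-1207/3669) * h6 + (7279/13453) * h7 + (6986/40359) * h8 + (23942/40359) * h9 + (-10136/13453) * h10 + (2084/40359) * h11 + (-12223/40359) * h12 + (9094/40359) * h13 + (-30520/40359) * h14 + (699/13453) * h15 + (-8560/121077) * h16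
  · change c 7 = 0
    linear_combination (10231/40359) * h0 + (13668/13453) * h1 + (-15451/40359) * h2 + (5129/40359) * h3 + (-39301/40359) * h4 + (-2419/13453) * h5 + (1312/3669) * h6 + (1277/13453) * h7 + (9049/40359) * h8 + (-20462/40359) * h9 + (10272/13453) * h10 + (-11339/40359) * h11 + (4243/40359) * h12 + (-11329/40359) * h13 + (19186/40359) * h14 + (-2609/13453) * h15 + (-18263/121077) * h16
  · change c 8 = 0
    linear_combination (-126487/161436) * h0 + (-50429/26906) * h1 + (79015/40359) * h2 + (-7147/80718) * h3 + (237965/80718) * h4 + (26615/13453) * h5 + (-1231/3669) * h6 + (4951/26906) * h7 + (11359/80718) * h8 + (126487/80718) * h9 + (-54683/26906) * h10 + (8923/80718) * h11 + (-24467/80718) * h12 + (28474/40359) * h13 + (-80134/40359) * h14 + (1747/26906) * h15 + (12229/242154) * h16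
  · change c 9 = 0
    linear_combination (-55537/161436) * h0 + (-17385/26906) * h1 + (88037/80718) * h2 + (-10421/40359) * h3 + (124379/80718) * h4 + (15362/13453) * h5 + (-1906/3669) * h6 + (13751/26906) * h7 + (41059/80718) * h8 + (55537/80718) * h9 + (-24983/26906) * h10 + (-7313/80718) * h11 + (-24599/80718) * h12 + (17683/40359) * h13 + (-34528/40359) * h14 + (97/26906) * h15 + (679/242154) * h16
  · change c 10 = 0
    linear_combination (133495/80718) * h0 + (56834/13453) * h1 + (-167807/40359) * h2 + (26111/80718) * h3 + (-259007/40359) * h4 + (-59593/13453) * h5 + (5540/3669) * h6 + (-7893/13453) * h7 + (-13033/40359) * h8 + (-133495/40359) * h9 + (60347/13453) * h10 + (-9769/40359) * h11 + (36362/40359) * h12 + (-62189/40359) * h13 + (163052/40359) * h14 + (-5323/13453) * h15 + (-37261/121077) * h16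
  · change c 11 = 0
    linear_combination (34585/80718) * h0 + (23345/13453) * h1 + (-23285/40359) * h2 + (7531/40359) * h3 + (-44054/40359) * h4 + (-10180/13453) * h5 + (-490/3669) * h6 + (2877/13453) * h7 + (9557/40359) * h8 + (-34585/40359) * h9 + (16895/13453) * h10 + (-19183/40359) * h11 + (2996/40359) * h12 + (-14030/40359) * h13 + (30878/40359) * h14 + (-463/13453) * h15 + (-3241/121077) * h16
  · change c 12 = 0
    linear_combination (-13174/40359) * h0 + (-23505/13453) * h1 + (-4637/40359) * h2 + (4523/80718) * h3 + (35758/40359) * h4 + (7913/13453) * h5 + (-913/3669) * h6 + (-73/13453) * h7 + (-3151/40359) * h8 + (26348/40359) * h9 + (-11712/13453) * h10 + (23867/40359) * h11 + (-5215/40359) * h12 + (6505/40359) * h13 + (-22630/40359) * h14 + (1466/13453) * h15 + (10262/121077) * h16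
  · change c 13 = 0
    linear_combination (140957/161436) * h0 + (78109/26906) * h1 + (-103339/80718) * h2 + (14849/80718) * h3 + (-228775/80718) * h4 + (-25588/13453) * h5 + (902/3669) * h6 + (-5735/26906) * h7 + (-16451/80718) * h8 + (-140957/80718) * h9 + (59375/26906) * h10 + (-38981/80718) * h11 + (18217/80718) * h12 + (-30032/40359) * h13 + (79691/40359) * h14 + (-377/26906) * h15 + (-2639/242154) * h16
  · change c 14 = 0
    linear_combination (2437/7338) * h0 + (675/1223) * h1 + (-5192/3669) * h2 + (289/3669) * h3 + (-5666/3669) * h4 + (-1252/1223) * h5 + (1168/3669) * h6 + (-58/1223) * h7 + (110/3669) * h8 + (-2437/3669) * h9 + (1333/1223) * h10 + (266/3669) * h11 + (380/3669) * h12 + (-1466/3669) * h13 + (4034/3669) * h14 + (-142/1223) * h15 + (-994/11007) * h16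
  · change c 15 = 0
    linear_combination (1489/40359) * h0 + (7033/26906) * h1 + (13045/80718) * h2 + (-7435/40359) * h3 + (1724/40359) * h4 + (763/13453) * h5 + (-248/3669) * h6 + (-920/13453) * h7 + (-4328/40359) * h8 + (-2978/40359) * h9 + (564/13453) * h10 + (-7123/80718) * h11 + (1726/40359) * h12 + (4580/40359) * h13 + (-2687/40359) * h14 + (784/13453) * h15 + (5488/121077) * h16
  · change c 16 = 0
    linear_combination (-30605/80718) * h0 + (-40751/26906) * h1 + (14899/40359) * h2 + (-18049/80718) * h3 + (32887/40359) * h4 + (7649/13453) * h5 + (-832/3669) * h6 + (-601/13453) * h7 + (-4933/40359) * h8 + (30605/40359) * h9 + (-13494/13453) * h10 + (15155/40359) * h11 + (-364/40359) * h12 + (12643/40359) * h13 + (-24874/40359) * h14 + (1565/13453) * h15 + (10955/121077) * h16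

theorem jacobian_span_rank :
    Module.finrank ℚ ↥(Submodule.span ℚ (Set.range jacGen)) = 17 := by
  rw [span_eq, finrank_span_eq_card jac_li, Fintype.card_fin]

end
end

section
/- Let f₀ ∈ ℚ[x₀, x₁, x₂, y₀, y₁, y₂] be the bidegree-(2,2) polynomial f₀ = Σ_{i,j=1}^{6} A_{ij} Q_{x,i} Q_{y,j}, where Qₓ = (x₀², x₀x₁, x₀x₂, x₁², x₁x₂, x₂²), Q_y = (y₀², y₀y₁, y₀y₂, y₁², y₁y₂, y₂²), and A is the symmetric 6×6 integer matrix with rows (1,1,−2,0,2,1), (1,1,0,1,0,2), (−2,0,−1,2,−1,0), (0,1,2,−1,−2,2), (2,0,−1,−2,0,2), (1,2,0,2,2,2). Then for every pair (a, b) with a, b ∈ {0, 1, 2}, the ideal of ℚ[x₀, x₁, x₂, y₀, y₁, y₂] generated by x_a − 1, y_b − 1, and the six partial derivatives ∂f₀/∂x₀, ∂f₀/∂x₁, ∂f₀/∂x₂, ∂f₀/∂y₀, ∂f₀/∂y₁, ∂f₀/∂y₂ is the unit ideal (contains 1). -/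
open MvPolynomial

noncomputable section

/-- The partial derivative of the form with respect to its variable number 0. -/
def q0 {R : Type*} [CommRing R] (a b c d e g : R) : R :=
      2*a*d^2 + 2*a*d*e - 4*a*d*g + 4*a*e*g + 2*a*g^2 + b*d^2 + b*d*e + b*e^2 + 2*b*g^2 -
      2*c*d^2 - c*d*g + 2*c*e^2 - c*e*g

/-- The partial derivative of the form with respect to its variable number 1. -/
def q1 {R : Type*} [CommRing R] (a b c d e g : R) : R :=
      a*d^2 + a*d*e + a*e^2 + 2*a*g^2 + 2*b*d*e + 4*b*d*g - 2*b*e^2 - 4*b*e*g + 4*b*g^2 +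
      2*c*d^2 - c*d*g - 2*c*e^2 + 2*c*g^2

/-- The partial derivative of the form with respect to its variable number 2. -/
def q2 {R : Type*} [CommRing R] (a b c d e g : R) : R :=
      - 2*a*d^2 - a*d*g + 2*a*e^2 - a*e*g + 2*b*d^2 - b*d*g - 2*b*e^2 + 2*b*g^2 + 2*c*d^2 +
      4*c*d*e + 4*c*e^2 + 4*c*e*g + 4*c*g^2

lemma c00 {k : Type*} [Field k] (h7 : (7 : k) = 0) (a b c d e g : k)
    (h1 : q0 a b c d e g = 0)
    (h2 : q1 a b c d e g = 0)
    (h3 : q2 a b c d e g = 0)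
    (h4 : q0 d e g a b c = 0)
    (h5 : q1 d e g a b c = 0)
    (h6 : q2 d e g a b c = 0) :
    a = 0 ∨ d = 0 := by
  simp only [q0, q1, q2] at h1 h2 h3 h4 h5 h6
  have key : a^5*d^3 = 0 := by
    linear_combination (- 3*a^4*e + a^4*g - 2*a^3*c*d + 3*a^3*c*e - 3*a^2*b^2*d - a^2*b*c*d + 2*a^2*b*c*e +
      a^2*c^2*d - 3*a^2*c^2*g - 2*a*b^2*c*d + 2*a*b^2*c*g + 3*a*b*c^2*e + a*b*c^2*g - 3*a*c^3*g
      + 2*b^3*c*g + 2*b^2*c^2*g + 3*c^4*d) * h1 + (- 3*a^4*e - 3*a^4*g + 3*a^3*b*d + 2*a^3*b*e -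
      a^3*c*d + 3*a^3*c*e - a^2*b^2*d + 2*a^2*b^2*e - 2*a^2*b^2*g + a^2*b*c*d + 3*a^2*b*c*g -
      2*a*b^3*e + a*b^3*g - 2*a*b^2*c*e + 3*a*b^2*c*g - 2*a*b*c^2*d - 3*a*b*c^2*e + a*b*c^2*g +
      2*a*c^3*g + b^4*g + b^3*c*d + 2*b^3*c*g + 3*b^2*c^2*d - 3*b*c^3*d - 3*c^4*e + 2*c^4*g) *
      h2 + (- a^4*d + 2*a^3*b*d + a^3*b*g + 2*a^3*c*d - 3*a^3*c*g - 2*a^2*b^2*e + 3*a^2*b^2*g +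
      3*a^2*b*c*d - a^2*c^2*d + 3*a^2*c^2*g - 3*a*b^3*e + a*b^3*g + 3*a*b^2*c*d + 3*a*b^2*c*g +
      2*a*b*c^2*e - 3*a*c^3*d + 3*a*c^3*e - b^3*c*d + 2*b^3*c*g + b^2*c^2*e + b^2*c^2*g +
      b*c^3*d + 2*b*c^3*e + 2*c^4*d) * h3 + (3*a^3*d^2 - 3*a^3*d*e - a^3*d*g - 3*a^3*e*g -
      a^3*g^2 - 3*a^2*b*d^2 - 3*a^2*b*d*e - a^2*b*d*g - 3*a^2*b*e^2 + 2*a^2*b*g^2 - a^2*c*d^2 -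
      3*a^2*c*e*g - 2*a^2*c*g^2 - a*b^2*d^2 + 2*a*b^2*e*g - a*b^2*g^2 - 2*a*b*c*d*e -
      3*a*b*c*d*g - 2*a*b*c*e^2 - 2*a*b*c*e*g - 3*a*c^2*d^2 + 2*a*c^2*d*g + 3*a*c^2*e^2 +
      2*a*c^2*g^2 + 3*b^3*d*g - b^3*e^2 + b^3*e*g + 2*b^3*g^2 + 3*b^2*c*d^2 + b^2*c*d*g -
      b^2*c*e*g - 3*b*c^2*d*g + 3*b*c^2*e*g - 3*c^3*d^2 + 2*c^3*d*g - 3*c^3*e^2 - c^3*e*g +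
      2*c^3*g^2) * h4 + (- 3*a^3*d*e - 3*a^3*e^2 - 3*a^3*e*g - 3*a^2*b*d^2 - 2*a^2*b*d*g +
      3*a^2*b*e*g - 3*a^2*c*d^2 - 3*a^2*c*d*e + 2*a^2*c*d*g + 3*a^2*c*g^2 - 2*a*b^2*d*e +
      2*a*b^2*e^2 + 3*a*b^2*e*g + 3*a*b^2*g^2 - 3*a*b*c*d*e + a*b*c*e^2 - a*b*c*e*g -
      2*a*b*c*g^2 + 3*a*c^2*e*g + 2*b^3*d*e - 3*b^3*e^2 + 3*b^3*e*g - 3*b^3*g^2 - b^2*c*d^2 -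
      b^2*c*e^2 + 3*b^2*c*e*g + b^2*c*g^2 + 2*b*c^2*d^2 + 2*b*c^2*d*e - 3*c^3*d^2 - c^3*d*e +
      2*c^3*g^2) * h5 + (3*a^3*d*e + 3*a^3*d*g - 2*a^3*e^2 + a^3*g^2 - 3*a^2*b*d^2 + a^2*b*d*e +
      2*a^2*b*e^2 - 2*a^2*b*g^2 - a^2*c*d*e + a^2*c*e*g + a^2*c*g^2 + 3*a*b^2*e^2 - a*b^2*e*g +
      3*a*b*c*d^2 + 2*a*b*c*d*e + 3*a*b*c*e^2 + 2*a*c^2*d*e - 3*a*c^2*d*g + 3*a*c^2*e^2 -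
      a*c^2*g^2 - b^3*d*e - b^3*e^2 - 2*b^2*c*d^2 + b^2*c*d*e - 2*b^2*c*d*g - b*c^2*d^2 -
      2*b*c^2*d*e + b*c^2*d*g - 2*b*c^2*e*g - 3*b*c^2*g^2 + 2*c^3*d^2 - 2*c^3*d*e + 3*c^3*e*g -
      2*c^3*g^2) * h6 + (- a^5*d^3 + 3*a^5*d^2*e + 2*a^5*d^2*g + a^5*d*e^2 - 2*a^5*d*e*g +
      a^5*e^3 + 4*a^5*e^2*g + a^5*e*g^2 + 3*a^4*b*d^2*e + 2*a^4*b*d^2*g + 3*a^4*b*d*e^2 +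
      a^4*b*d*e*g - a^4*b*d*g^2 - 2*a^4*b*e^2*g + 2*a^4*b*g^3 + 4*a^4*c*d^3 - a^4*c*d^2*e +
      a^4*c*d*e^2 + 3*a^4*c*d*e*g + a^4*c*e^3 - a^4*c*e^2*g - 3*a^4*c*e*g^2 - a^4*c*g^3 +
      2*a^3*b^2*d^3 + a^3*b^2*d^2*e - 2*a^3*b^2*d^2*g + 4*a^3*b^2*d*e^2 + a^3*b^2*d*e*g -
      3*a^3*b^2*d*g^2 - a^3*b^2*e^3 - 3*a^3*b^2*e^2*g - a^3*b^2*e*g^2 - 3*a^3*b*c*d^3 +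
      2*a^3*b*c*d^2*e + a^3*b*c*d^2*g - 4*a^3*b*c*d*e^2 - 3*a^3*b*c*d*g^2 - a^3*b*c*e^3 -
      5*a^3*b*c*e^2*g - 6*a^3*b*c*e*g^2 - a^3*b*c*g^3 - 2*a^3*c^2*d^3 + 2*a^3*c^2*d^2*e +
      3*a^3*c^2*d*e^2 - 2*a^3*c^2*d*e*g - 4*a^3*c^2*d*g^2 + a^3*c^2*e^3 + 6*a^3*c^2*e^2*g +
      a^3*c^2*e*g^2 + 3*a^3*c^2*g^3 + 2*a^2*b^3*d^3 - a^2*b^3*d^2*e + a^2*b^3*d^2*g +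
      a^2*b^3*d*e^2 - 5*a^2*b^3*d*e*g + 4*a^2*b^3*d*g^2 + 2*a^2*b^3*e^3 - a^2*b^3*e^2*g -
      2*a^2*b^3*e*g^2 + 2*a^2*b^3*g^3 + 2*a^2*b^2*c*d^2*e - a^2*b^2*c*d^2*g + 6*a^2*b^2*c*d*e^2
      - 3*a^2*b^2*c*d*e*g - 2*a^2*b^2*c*d*g^2 + a^2*b^2*c*e^3 - 3*a^2*b^2*c*e^2*g -
      2*a^2*b^2*c*g^3 + 2*a^2*b*c^2*d^3 + a^2*b*c^2*d^2*e - a^2*b*c^2*d*e^2 - a^2*b*c^2*d*e*g -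
      a^2*b*c^2*e^3 - 4*a^2*b*c^2*e^2*g + 2*a^2*b*c^2*e*g^2 + a^2*c^3*d^3 + 4*a^2*c^3*d^2*e -
      2*a^2*c^3*d^2*g + 7*a^2*c^3*d*e^2 + 2*a^2*c^3*d*e*g - 2*a^2*c^3*d*g^2 - 3*a^2*c^3*e^2*g -
      3*a^2*c^3*e*g^2 - 2*a^2*c^3*g^3 + a*b^4*d^2*e - a*b^4*d^2*g - a*b^4*d*e^2 - a*b^4*d*e*g -
      a*b^4*d*g^2 + a*b^4*e^3 - 2*a*b^4*e^2*g + 5*a*b^4*e*g^2 - 2*a*b^3*c*d^3 + 2*a*b^3*c*d^2*e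
      - a*b^3*c*d^2*g - 4*a*b^3*c*d*e*g + 4*a*b^3*c*d*g^2 + 5*a*b^3*c*e^3 - 3*a*b^3*c*e^2*g +
      8*a*b^3*c*e*g^2 - 6*a*b^3*c*g^3 + 3*a*b^2*c^2*d^2*g - 2*a*b^2*c^2*d*e^2 -
      8*a*b^2*c^2*d*e*g - 2*a*b^2*c^2*e^3 - 14*a*b^2*c^2*e^2*g - 3*a*b^2*c^2*e*g^2 -
      3*a*b^2*c^2*g^3 + 5*a*b*c^3*d^3 + 2*a*b*c^3*d^2*e - 6*a*b*c^3*d^2*g - 2*a*b*c^3*d*e^2 +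
      4*a*b*c^3*d*e*g + a*b*c^3*d*g^2 - 3*a*b*c^3*e^3 - a*b*c^3*e*g^2 + 2*a*b*c^3*g^3 +
      3*a*c^4*d^2*e - 3*a*c^4*d*e^2 - 2*a*c^4*d*e*g + 3*a*c^4*d*g^2 - 3*a*c^4*e^3 -
      4*a*c^4*e^2*g - 4*a*c^4*e*g^2 + b^5*d*e^2 - b^5*d*g^2 - b^5*e^3 + b^5*e^2*g - 2*b^5*g^3 +
      b^4*c*d^3 - 2*b^4*c*d^2*e - 3*b^4*c*d^2*g + 2*b^4*c*d*e^2 - 2*b^4*c*d*e*g - b^4*c*d*g^2 -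
      2*b^4*c*e^3 + 4*b^4*c*e^2*g + b^4*c*e*g^2 - 2*b^4*c*g^3 - 2*b^3*c^2*d^3 - b^3*c^2*d^2*e -
      2*b^3*c^2*d^2*g + 2*b^3*c^2*d*e^2 + 2*b^3*c^2*d*e*g + 2*b^3*c^2*d*g^2 + 2*b^3*c^2*e^3 -
      b^3*c^2*e^2*g - b^3*c^2*e*g^2 - 2*b^2*c^3*d^3 + 2*b^2*c^3*d^2*e + 5*b^2*c^3*d^2*g -
      4*b^2*c^3*d*e*g + b^2*c^3*e^3 - b^2*c^3*e^2*g - 3*b^2*c^3*e*g^2 + 2*b^2*c^3*g^3 +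
      b*c^4*d^3 - 5*b*c^4*d^2*e - 2*b*c^4*d^2*g - b*c^4*d*e^2 + 3*b*c^4*d*e*g - 4*b*c^4*d*g^2 -
      2*b*c^4*e^3 - 3*b*c^4*e^2*g + 3*b*c^4*e*g^2 + 2*b*c^4*g^3 + 2*c^5*d^3 + 2*c^5*d^2*e -
      c^5*d^2*g - 2*c^5*d*g^2 - 2*c^5*e*g^2) * h7
  simpa using key

lemma c10 {k : Type*} [Field k] (h7 : (7 : k) = 0) (b c d e g : k)
    (h1 : q0 0 b c d e g = 0)
    (h2 : q1 0 b c d e g = 0)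
    (h3 : q2 0 b c d e g = 0)
    (h4 : q0 d e g 0 b c = 0)
    (h5 : q1 d e g 0 b c = 0)
    (h6 : q2 d e g 0 b c = 0) :
    b = 0 ∨ d = 0 := by
  simp only [q0, q1, q2] at h1 h2 h3 h4 h5 h6
  have key : b^4*d^2 = 0 := by
    linear_combination (3*b^3 - 3*b^2*c - b*c^2 - c^3) * h1 + (- c^3) * h2 + (3*b^3 + b^2*c - b*c^2) * h3 +
      (3*b^2*e + b^2*g - b*c*d - c^2*g) * h4 + (- 3*b^2*d - 2*b*c*d + 3*b*c*e) * h5 + (b^2*d +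
      2*b*c*d - 3*c^2*g) * h6 + (- b^4*d^2 - b^4*d*e - b^4*d*g - b^4*e*g - 2*b^4*g^2 -
      5*b^3*c*d*e - 2*b^3*c*d*g - b^3*c*e^2 - b^3*c*g^2 + b^2*c^2*d^2 - b^2*c^2*d*e -
      b^2*c^2*d*g + b^2*c^2*e^2 - 2*b^2*c^2*e*g + 2*b^2*c^2*g^2 + b*c^3*d^2 + b*c^3*d*e -
      b*c^3*e^2 - b*c^3*e*g + 3*b*c^3*g^2 + c^4*e*g + 2*c^4*g^2) * h7
  simpa using key

lemma c20 {k : Type*} [Field k] (h7 : (7 : k) = 0) (c d e g : k)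
    (h1 : q0 0 0 c d e g = 0)
    (h2 : q1 0 0 c d e g = 0)
    (h3 : q2 0 0 c d e g = 0)
    (h4 : q0 d e g 0 0 c = 0)
    (h5 : q1 d e g 0 0 c = 0)
    (h6 : q2 d e g 0 0 c = 0) :
    c = 0 ∨ d = 0 := by
  simp only [q0, q1, q2] at h1 h2 h3 h4 h5 h6
  have key : c^2*d = 0 := by
    linear_combination (- 2) * h4 + (- 1) * h5 + (- 3) * h6 + (c^2*d + 2*c^2*e + 2*c^2*g) * h7
  simpa using key

lemma c11 {k : Type*} [Field k] (h7 : (7 : k) = 0) (b c e g : k)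
    (h1 : q0 0 b c 0 e g = 0)
    (h2 : q1 0 b c 0 e g = 0)
    (h3 : q2 0 b c 0 e g = 0)
    (h4 : q0 0 e g 0 b c = 0)
    (h5 : q1 0 e g 0 b c = 0)
    (h6 : q2 0 e g 0 b c = 0) :
    b = 0 ∨ e = 0 := by
  simp only [q0, q1, q2] at h1 h2 h3 h4 h5 h6
  have key : b^2*e^2 = 0 := by
    linear_combination (3*c) * h1 + (- b) * h2 + (- 2*e + 3*g) * h4 + (3*e - 3*g) * h5 + (- 2*g) * h6 + (b^2*e^2
      - b^2*e*g + b*c*e^2 - 2*b*c*e*g + b*c*g^2 - 2*c^2*e^2 + c^2*e*g + 2*c^2*g^2) * h7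
  simpa using key

lemma c21 {k : Type*} [Field k] (h7 : (7 : k) = 0) (c e g : k)
    (h1 : q0 0 0 c 0 e g = 0)
    (h2 : q1 0 0 c 0 e g = 0)
    (h3 : q2 0 0 c 0 e g = 0)
    (h4 : q0 0 e g 0 0 c = 0)
    (h5 : q1 0 e g 0 0 c = 0)
    (h6 : q2 0 e g 0 0 c = 0) :
    c = 0 ∨ e = 0 := by
  simp only [q0, q1, q2] at h1 h2 h3 h4 h5 h6
  have key : c^2*e = 0 := by
    linear_combination (- 3) * h4 + (c^2*e) * h7
  simpa using key

lemma c22 {k : Type*} [Field k] (h7 : (7 : k) = 0) (c g : k)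
    (h1 : q0 0 0 c 0 0 g = 0)
    (h2 : q1 0 0 c 0 0 g = 0)
    (h3 : q2 0 0 c 0 0 g = 0)
    (h4 : q0 0 0 g 0 0 c = 0)
    (h5 : q1 0 0 g 0 0 c = 0)
    (h6 : q2 0 0 g 0 0 c = 0) :
    c = 0 ∨ g = 0 := by
  simp only [q0, q1, q2] at h1 h2 h3 h4 h5 h6
  have key : c*g^2 = 0 := by
    linear_combination (- 3) * h2 + (c*g^2) * h7
  simpa using key

lemma q0_map {R S : Type*} [CommRing R] [CommRing S] (φ : R →+* S) (a b c d e g : R) :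
    φ (q0 a b c d e g) = q0 (φ a) (φ b) (φ c) (φ d) (φ e) (φ g) := by
  simp [q0, map_ofNat φ]

lemma q1_map {R S : Type*} [CommRing R] [CommRing S] (φ : R →+* S) (a b c d e g : R) :
    φ (q1 a b c d e g) = q1 (φ a) (φ b) (φ c) (φ d) (φ e) (φ g) := by
  simp [q1, map_ofNat φ]

lemma q2_map {R S : Type*} [CommRing R] [CommRing S] (φ : R →+* S) (a b c d e g : R) :
    φ (q2 a b c d e g) = q2 (φ a) (φ b) (φ c) (φ d) (φ e) (φ g) := by
  simp [q2, map_ofNat φ]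

/-- The point `(x, y)` kills all six partial derivatives. -/
def Sing {R : Type*} [CommRing R] (x y : Fin 3 → R) : Prop :=
  (q0 (x 0) (x 1) (x 2) (y 0) (y 1) (y 2) = 0 ∧ q1 (x 0) (x 1) (x 2) (y 0) (y 1) (y 2) = 0 ∧
    q2 (x 0) (x 1) (x 2) (y 0) (y 1) (y 2) = 0) ∧
  (q0 (y 0) (y 1) (y 2) (x 0) (x 1) (x 2) = 0 ∧ q1 (y 0) (y 1) (y 2) (x 0) (x 1) (x 2) = 0 ∧
    q2 (y 0) (y 1) (y 2) (x 0) (x 1) (x 2) = 0)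

lemma Sing.swap {R : Type*} [CommRing R] {x y : Fin 3 → R} (h : Sing x y) : Sing y x :=
  ⟨h.2, h.1⟩

lemma Sing.map {R S : Type*} [CommRing R] [CommRing S] (φ : R →+* S) {x y : Fin 3 → R}
    (h : Sing x y) : Sing (fun i => φ (x i)) (fun i => φ (y i)) := by
  obtain ⟨⟨h1, h2, h3⟩, h4, h5, h6⟩ := h
  simp only [Sing, ← q0_map, ← q1_map, ← q2_map, h1, h2, h3, h4, h5, h6, map_zero, and_self]

lemma Sing.of_map {R S : Type*} [CommRing R] [CommRing S] (φ : R →+* S)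
    (hφ : Function.Injective φ) {x y : Fin 3 → R}
    (h : Sing (fun i => φ (x i)) (fun i => φ (y i))) : Sing x y := by
  simpa only [Sing, ← q0_map, ← q1_map, ← q2_map, map_eq_zero_iff φ hφ] using h

lemma Sing.scale {R : Type*} [CommRing R] (s t : R) {x y : Fin 3 → R}
    (h : Sing x y) : Sing (fun i => s * x i) (fun i => t * y i) := by
  obtain ⟨⟨h1, h2, h3⟩, h4, h5, h6⟩ := h
  simp only [q0, q1, q2] at h1 h2 h3 h4 h5 h6
  simp only [Sing, q0, q1, q2]
  refine ⟨⟨?_, ?_, ?_⟩, ?_, ?_, ?_⟩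
  · linear_combination s * t ^ 2 * h1
  · linear_combination s * t ^ 2 * h2
  · linear_combination s * t ^ 2 * h3
  · linear_combination t * s ^ 2 * h4
  · linear_combination t * s ^ 2 * h5
  · linear_combination t * s ^ 2 * h6

/-- If `x₀ = 0` and `x ≠ 0` then `y₀ = 0`. -/
lemma step_one {k : Type*} [Field k] (h7 : (7 : k) = 0) {x y : Fin 3 → k} (h : Sing x y)
    (hx : x 0 = 0) (hx' : ¬ (x 0 = 0 ∧ x 1 = 0 ∧ x 2 = 0)) : y 0 = 0 := by
  obtain ⟨⟨h1, h2, h3⟩, h4, h5, h6⟩ := h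
  rw [hx] at h1 h2 h3 h4 h5 h6
  rcases c10 h7 _ _ _ _ _ h1 h2 h3 h4 h5 h6 with h | h
  · rw [h] at h1 h2 h3 h4 h5 h6
    rcases c20 h7 _ _ _ _ h1 h2 h3 h4 h5 h6 with h' | h'
    · exact absurd ⟨hx, h, h'⟩ hx'
    · exact h'
  · exact h

/-- If `x₀ = y₀ = 0`, `x₁ = 0` and `x ≠ 0` then `y = 0`. -/
lemma step_two {k : Type*} [Field k] (h7 : (7 : k) = 0) {x y : Fin 3 → k} (h : Sing x y)
    (hx : x 0 = 0) (hy : y 0 = 0) (hx1 : x 1 = 0)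
    (hx' : ¬ (x 0 = 0 ∧ x 1 = 0 ∧ x 2 = 0)) : y 0 = 0 ∧ y 1 = 0 ∧ y 2 = 0 := by
  obtain ⟨⟨h1, h2, h3⟩, h4, h5, h6⟩ := h
  rw [hx, hy, hx1] at h1 h2 h3 h4 h5 h6
  have hx2 : x 2 ≠ 0 := fun h => hx' ⟨hx, hx1, h⟩
  have hy1 := (c21 h7 _ _ _ h1 h2 h3 h4 h5 h6).resolve_left hx2
  rw [hy1] at h1 h2 h3 h4 h5 h6
  exact ⟨hy, hy1, (c22 h7 _ _ h1 h2 h3 h4 h5 h6).resolve_left hx2⟩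

/-- There is no singular point in characteristic `7`. -/
lemma no_sing_seven {k : Type*} [Field k] (h7 : (7 : k) = 0) {x y : Fin 3 → k} (h : Sing x y)
    (hx' : ¬ (x 0 = 0 ∧ x 1 = 0 ∧ x 2 = 0)) (hy' : ¬ (y 0 = 0 ∧ y 1 = 0 ∧ y 2 = 0)) : False := by
  have h00 : x 0 = 0 ∧ y 0 = 0 := by
    rcases c00 h7 _ _ _ _ _ _ h.1.1 h.1.2.1 h.1.2.2 h.2.1 h.2.2.1 h.2.2.2 with h0 | h0
    · exact ⟨h0, step_one h7 h h0 hx'⟩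
    · exact ⟨step_one h7 h.swap h0 hy', h0⟩
  obtain ⟨hx, hy⟩ := h00
  have h11 : x 1 = 0 ∨ y 1 = 0 := by
    obtain ⟨⟨h1, h2, h3⟩, h4, h5, h6⟩ := h
    rw [hx, hy] at h1 h2 h3 h4 h5 h6
    exact c11 h7 _ _ _ _ h1 h2 h3 h4 h5 h6
  rcases h11 with h1 | h1
  · exact hy' (step_two h7 h hx hy h1 hx')
  · exact hx' (step_two h7 h.swap hy hx h1 hy')

/-- Rescaling a nonzero vector to a primitive integral vector. -/
lemma exists_primitive {K : Type*} [Field K] (V : ValuationSubring K) (x : Fin 3 → K)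
    (i : Fin 3) (hi : x i ≠ 0) :
    ∃ (s : K) (z : Fin 3 → V) (j : Fin 3), (∀ l, (z l : K) = s * x l) ∧ z j = 1 := by
  obtain ⟨j, hj⟩ := Finite.exists_max (fun l => V.valuation (x l))
  have hj0 : x j ≠ 0 := by
    intro h0
    have := hj i
    rw [h0, map_zero, le_zero_iff, map_eq_zero] at this
    exact hi this
  have hpos : V.valuation (x j) ≠ 0 := by simpa using hj0
  refine ⟨(x j)⁻¹, fun l => ⟨(x j)⁻¹ * x l, ?_⟩, j, fun l => rfl, ?_⟩
  · rw [← V.valuation_le_one_iff, map_mul, map_inv₀]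
    calc _ ≤ (V.valuation (x j))⁻¹ * V.valuation (x j) := by gcongr; exact hj l
      _ = 1 := inv_mul_cancel₀ hpos
  · apply Subtype.ext
    simp [hj0]

/-- There is a valuation ring of a field of characteristic zero in which `7` is not a unit. -/
lemma exists_valuation (K : Type*) [Field K] [CharZero K] :
    ∃ V : ValuationSubring K, (7 : V) ∈ IsLocalRing.maximalIdeal V := by
  let S : Subring K := (Int.castRingHom K).range
  have hI : (Ideal.span {(7 : S)}) ≠ ⊤ := by
    rw [Ne, Ideal.span_singleton_eq_top]
    intro hu
    obtain ⟨⟨_, n, rfl⟩, hn⟩ := hu.exists_right_inv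
    have h2 := congrArg Subtype.val hn
    have h3 : ((7 * n : ℤ) : K) = ((1 : ℤ) : K) := by
      push_cast
      exact h2
    have h4 : 7 * n = 1 := Int.cast_injective h3
    lia
  obtain ⟨V, -, hV⟩ := Ideal.image_subset_nonunits_valuationSubring _ hI
  refine ⟨V, ?_⟩
  rw [← ValuationSubring.coe_mem_nonunits_iff]
  exact hV ⟨7, Ideal.subset_span rfl, rfl⟩

/-- There is no singular point in characteristic zero. -/
lemma no_sing_zero {K : Type*} [Field K] [CharZero K] {x y : Fin 3 → K} (h : Sing x y)
    (i j : Fin 3) (hi : x i ≠ 0) (hj : y j ≠ 0) : False := by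
  obtain ⟨V, hV⟩ := exists_valuation K
  obtain ⟨s, z, a, hz, ha⟩ := exists_primitive V x i hi
  obtain ⟨t, w, b, hw, hb⟩ := exists_primitive V y j hj
  have h1 : Sing z w := by
    refine Sing.of_map V.subtype Subtype.val_injective ?_
    have := h.scale s t
    simp only [← hz, ← hw] at this
    exact this
  have h2 := h1.map (IsLocalRing.residue V)
  have h7 : (7 : IsLocalRing.ResidueField V) = 0 := by
    have := (IsLocalRing.residue_eq_zero_iff (7 : V)).2 hV
    rwa [map_ofNat (IsLocalRing.residue V)] at this
  refine no_sing_seven h7 h2 ?_ ?_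
  · rintro ⟨e0, e1, e2⟩
    have : IsLocalRing.residue V (z a) = 0 := by fin_cases a <;> assumption
    simp [ha] at this
  · rintro ⟨e0, e1, e2⟩
    have : IsLocalRing.residue V (w b) = 0 := by fin_cases b <;> assumption
    simp [hb] at this

/-- `f₀` written out as a quadratic form in the `x` variables. -/
lemma f0_expand : f0 =
    xv 0 ^ 2 * (yv 0 ^ 2 + yv 0 * yv 1 - 2 * (yv 0 * yv 2) + 2 * (yv 1 * yv 2) + yv 2 ^ 2) +
    xv 0 * xv 1 * (yv 0 ^ 2 + yv 0 * yv 1 + yv 1 ^ 2 + 2 * yv 2 ^ 2) +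
    xv 0 * xv 2 * (-2 * yv 0 ^ 2 - yv 0 * yv 2 + 2 * yv 1 ^ 2 - yv 1 * yv 2) +
    xv 1 ^ 2 * (yv 0 * yv 1 + 2 * (yv 0 * yv 2) - yv 1 ^ 2 - 2 * (yv 1 * yv 2) + 2 * yv 2 ^ 2) +
    xv 1 * xv 2 * (2 * yv 0 ^ 2 - yv 0 * yv 2 - 2 * yv 1 ^ 2 + 2 * yv 2 ^ 2) +
    xv 2 ^ 2 * (yv 0 ^ 2 + 2 * (yv 0 * yv 1) + 2 * yv 1 ^ 2 + 2 * (yv 1 * yv 2) +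
      2 * yv 2 ^ 2) := by
  have h2 : (C (2 : ℚ) : MvPolynomial (Fin 3 ⊕ Fin 3) ℚ) = 2 := map_ofNat C 2
  simp only [f0, Fin.sum_univ_six, A, Qx, Qy, Matrix.of_apply, Matrix.cons_val, map_neg, h2,
    map_one, map_zero]
  ring

lemma pderiv_x (i j : Fin 3) : pderiv (Sum.inl i) (xv j) = if i = j then 1 else 0 := by
  simp [xv, pderiv_X, Pi.single_apply, eq_comm]

lemma pderiv_y (i j : Fin 3) : pderiv (Sum.inr i) (yv j) = if i = j then 1 else 0 := by
  simp [yv, pderiv_X, Pi.single_apply, eq_comm]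

lemma pderiv_xy (i j : Fin 3) : pderiv (Sum.inl i) (yv j) = 0 := by
  simp [yv, pderiv_X, Pi.single_apply]

lemma pderiv_yx (i j : Fin 3) : pderiv (Sum.inr i) (xv j) = 0 := by
  simp [xv, pderiv_X, Pi.single_apply]

lemma pderiv_two (i : Fin 3 ⊕ Fin 3) :
    pderiv i (2 : MvPolynomial (Fin 3 ⊕ Fin 3) ℚ) = 0 := by
  rw [← map_ofNat (C : ℚ →+* MvPolynomial (Fin 3 ⊕ Fin 3) ℚ) 2, pderiv_C]

lemma sing_generic : Sing (R := MvPolynomial (Fin 3 ⊕ Fin 3) ℚ ⧸ Ideal.span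
    (Set.range (fun i : Fin 3 ⊕ Fin 3 => pderiv i f0)))
    (fun i => Ideal.Quotient.mk _ (xv i)) (fun i => Ideal.Quotient.mk _ (yv i)) := by
  simp only [Sing, ← q0_map, ← q1_map, ← q2_map, Ideal.Quotient.eq_zero_iff_mem]
  refine ⟨⟨?_, ?_, ?_⟩, ?_, ?_, ?_⟩
  · refine Ideal.subset_span ⟨Sum.inl 0, ?_⟩
    simp [f0_expand, pow_two, pderiv_x, pderiv_xy, pderiv_two, q0]
    ring
  · refine Ideal.subset_span ⟨Sum.inl 1, ?_⟩
    simp [f0_expand, pow_two, pderiv_x, pderiv_xy, pderiv_two, q1]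
    ring
  · refine Ideal.subset_span ⟨Sum.inl 2, ?_⟩
    simp [f0_expand, pow_two, pderiv_x, pderiv_xy, pderiv_two, q2]
    ring
  · refine Ideal.subset_span ⟨Sum.inr 0, ?_⟩
    simp [f0_expand, pow_two, pderiv_y, pderiv_yx, pderiv_two, q0]
    ring
  · refine Ideal.subset_span ⟨Sum.inr 1, ?_⟩
    simp [f0_expand, pow_two, pderiv_y, pderiv_yx, pderiv_two, q1]
    ring
  · refine Ideal.subset_span ⟨Sum.inr 2, ?_⟩
    simp [f0_expand, pow_two, pderiv_y, pderiv_yx, pderiv_two, q2]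
    ring

lemma sing_of_pderiv {K : Type*} [CommRing K] (φ : MvPolynomial (Fin 3 ⊕ Fin 3) ℚ →+* K)
    (h : ∀ i, φ (pderiv i f0) = 0) : Sing (fun i => φ (xv i)) (fun i => φ (yv i)) := by
  have hle : ∀ p ∈ Ideal.span (Set.range (fun i : Fin 3 ⊕ Fin 3 => pderiv i f0)), φ p = 0 := by
    intro p hp
    have : Ideal.span (Set.range (fun i : Fin 3 ⊕ Fin 3 => pderiv i f0)) ≤ RingHom.ker φ := by
      rw [Ideal.span_le]
      rintro _ ⟨i, rfl⟩
      exact h i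
    exact this hp
  exact sing_generic.map (Ideal.Quotient.lift _ φ hle)

theorem branch_divisor_smooth_charts :
    ∀ a b : Fin 3,
      (1 : MvPolynomial (Fin 3 ⊕ Fin 3) ℚ) ∈
        Ideal.span ({xv a - 1, yv b - 1} ∪
          Set.range (fun i : Fin 3 ⊕ Fin 3 => pderiv i f0)) := by
  intro a b
  by_contra hne
  have hne' := (Ideal.ne_top_iff_one _).2 hne
  obtain ⟨M, hM, hle⟩ := Ideal.exists_le_maximal _ hne'
  let _ : Field (MvPolynomial (Fin 3 ⊕ Fin 3) ℚ ⧸ M) := Ideal.Quotient.field M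
  have _ : CharZero (MvPolynomial (Fin 3 ⊕ Fin 3) ℚ ⧸ M) :=
    algebraRat.charZero _
  have hz : ∀ p ∈ ({xv a - 1, yv b - 1} ∪
      Set.range (fun i : Fin 3 ⊕ Fin 3 => pderiv i f0) : Set (MvPolynomial (Fin 3 ⊕ Fin 3) ℚ)),
      Ideal.Quotient.mk M p = 0 := fun p hp =>
    Ideal.Quotient.eq_zero_iff_mem.2 (hle (Ideal.subset_span hp))
  have hS := sing_of_pderiv (Ideal.Quotient.mk M) (fun i => hz _ (Or.inr ⟨i, rfl⟩))
  have hx := hz (xv a - 1) (Or.inl (Or.inl rfl))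
  have hy := hz (yv b - 1) (Or.inl (Or.inr rfl))
  rw [map_sub, map_one, sub_eq_zero] at hx hy
  refine no_sing_zero hS a b ?_ ?_
  · simp only [hx]; exact one_ne_zero
  · simp only [hy]; exact one_ne_zero

end
end

section
/- For each natural number m, define the rational number c_m = Σ_{ℓ=0}^{m} (2m)! / (ℓ!³ · m! · ((m−ℓ)!)³). Then for every integer m ≥ 2, the following recurrence holds: m⁵(m−1)·c_m = (28(m−1)⁴ + 42(m−1)³ + 22(m−1)² + 4(m−1))·c_{m−1} + (128(m−2)² + 256(m−2) + 96)·c_{m−2}. -/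
/-- The coefficients of the quantum period of the Verra fourfold. -/
noncomputable def c (m : ℕ) : ℚ :=
  ∑ ℓ ∈ Finset.range (m + 1),
    ((2 * m).factorial : ℚ) /
      ((ℓ.factorial : ℚ) ^ 3 * (m.factorial : ℚ) * ((m - ℓ).factorial : ℚ) ^ 3)

/-- The Franel-type summand. -/
noncomputable def tt (n k : ℕ) : ℚ :=
  1 / ((k.factorial : ℚ) ^ 3 * ((n - k).factorial : ℚ) ^ 3)

/-- The Franel-type sum. -/
noncomputable def SS (n : ℕ) : ℚ := ∑ k ∈ Finset.range (n + 1), tt n k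

/-- The prefactor. -/
noncomputable def ww (n : ℕ) : ℚ := ((2 * n).factorial : ℚ) / (n.factorial : ℚ)

/-- The polynomial part of the Zeilberger certificate. -/
def PP (n k : ℚ) : ℚ :=
  4 * k ^ 3 + (6 - 18 * n) * k ^ 2 + (27 * n ^ 2 - 15 * n) * k + (10 * n ^ 2 - 14 * n ^ 3)

lemma c_eq (n : ℕ) : c n = ww n * SS n := by
  unfold c ww SS
  rw [Finset.mul_sum]
  refine Finset.sum_congr rfl fun k _ => ?_
  unfold tt
  have h1 := Nat.cast_ne_zero (R := ℚ).2 n.factorial_ne_zero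
  have h2 := Nat.cast_ne_zero (R := ℚ).2 k.factorial_ne_zero
  have h3 := Nat.cast_ne_zero (R := ℚ).2 (n - k).factorial_ne_zero
  field_simp

lemma ww_succ (n : ℕ) : ww (n + 1) = 2 * (2 * n + 1) * ww n := by
  unfold ww
  have h1 := Nat.cast_ne_zero (R := ℚ).2 n.factorial_ne_zero
  have h4 : (n : ℚ) + 1 ≠ 0 := by positivity
  rw [show 2 * (n + 1) = 2 * n + 1 + 1 by ring, Nat.factorial_succ, Nat.factorial_succ,
    Nat.factorial_succ]
  push_cast
  field_simp
  ring

lemma tt_down (n k : ℕ) (h : k ≤ n) : tt n k = ((n : ℚ) + 1 - k) ^ 3 * tt (n + 1) k := by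
  obtain ⟨d, rfl⟩ := Nat.exists_eq_add_of_le h
  unfold tt
  rw [show k + d + 1 - k = d + 1 by omega, show k + d - k = d by omega, Nat.factorial_succ]
  have h1 := Nat.cast_ne_zero (R := ℚ).2 k.factorial_ne_zero
  have h2 := Nat.cast_ne_zero (R := ℚ).2 d.factorial_ne_zero
  have h4 : (d : ℚ) + 1 ≠ 0 := by positivity
  push_cast
  rw [show (k : ℚ) + d + 1 - k = d + 1 by ring]
  field_simp

lemma tt_shift (n k : ℕ) (h : k < n) :
    ((k : ℚ) + 1) ^ 3 * tt n (k + 1) = ((n : ℚ) - k) ^ 3 * tt n k := by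
  obtain ⟨d, rfl⟩ := Nat.exists_eq_add_of_lt h
  unfold tt
  rw [show k + d + 1 - k = d + 1 by omega, show k + d + 1 - (k + 1) = d by omega,
    Nat.factorial_succ, Nat.factorial_succ]
  have h1 := Nat.cast_ne_zero (R := ℚ).2 k.factorial_ne_zero
  have h2 := Nat.cast_ne_zero (R := ℚ).2 d.factorial_ne_zero
  have h4 : (d : ℚ) + 1 ≠ 0 := by positivity
  have h5 : (k : ℚ) + 1 ≠ 0 := by positivity
  push_cast
  rw [show (k : ℚ) + d + 1 - k = d + 1 by ring]
  field_simp

lemma SS_down (n : ℕ) :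
    SS n = ∑ k ∈ Finset.range (n + 2), ((n : ℚ) + 1 - k) ^ 3 * tt (n + 1) k := by
  rw [Finset.sum_range_succ]
  unfold SS
  push_cast
  rw [sub_self, zero_pow (by norm_num), zero_mul, add_zero]
  exact Finset.sum_congr rfl fun k hk =>
    tt_down n k (by have := Finset.mem_range.1 hk; omega)

lemma SS_down2 (n : ℕ) :
    SS n = ∑ k ∈ Finset.range (n + 3),
      ((n : ℚ) + 1 - k) ^ 3 * (((n : ℚ) + 2 - k) ^ 3 * tt (n + 2) k) := by
  rw [Finset.sum_range_succ, SS_down]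
  push_cast
  rw [sub_self, zero_pow (by norm_num), zero_mul, mul_zero, add_zero]
  refine Finset.sum_congr rfl fun k hk => ?_
  rw [tt_down (n + 1) k (by have := Finset.mem_range.1 hk; omega)]
  push_cast
  ring

lemma tele (n M : ℕ) (h : M ≤ n) :
    ∑ k ∈ Finset.range M, (((n : ℚ) - k) ^ 3 * PP n (k + 1) - (k : ℚ) ^ 3 * PP n k) * tt n k
      = (M : ℚ) ^ 3 * PP n M * tt n M := by
  induction M with
  | zero => simp
  | succ M ih =>
    rw [Finset.sum_range_succ, ih (by omega)]
    have := tt_shift n M (by omega)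
    push_cast
    linear_combination (-PP n (M + 1)) * this

lemma tele_full (n : ℕ) :
    ∑ k ∈ Finset.range (n + 1),
      (((n : ℚ) - k) ^ 3 * PP n (k + 1) - (k : ℚ) ^ 3 * PP n k) * tt n k = 0 := by
  rw [Finset.sum_range_succ, tele n n le_rfl]
  ring

lemma SS_rec (b : ℕ) :
    ((b : ℚ) + 2) ^ 5 * (b + 1) * SS (b + 2)
      = (7 * ((b : ℚ) + 2) ^ 2 - 7 * (b + 2) + 2) * (b + 1) * SS (b + 1) + 8 * SS b := by
  have h := tele_full (b + 2)
  rw [SS_down2 b, SS_down (b + 1)]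
  unfold SS
  rw [← sub_eq_zero, Finset.mul_sum, Finset.mul_sum, Finset.mul_sum, ← Finset.sum_add_distrib,
    ← Finset.sum_sub_distrib, ← h]
  refine Finset.sum_congr rfl fun k _ => ?_
  unfold PP
  push_cast
  ring

theorem quantum_period_recurrence (m : ℕ) (hm : 2 ≤ m) :
    (m : ℚ) ^ 5 * ((m : ℚ) - 1) * c m
      = (28 * ((m : ℚ) - 1) ^ 4 + 42 * ((m : ℚ) - 1) ^ 3
          + 22 * ((m : ℚ) - 1) ^ 2 + 4 * ((m : ℚ) - 1)) * c (m - 1)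
        + (128 * ((m : ℚ) - 2) ^ 2 + 256 * ((m : ℚ) - 2) + 96) * c (m - 2) := by
  obtain ⟨b, rfl⟩ := Nat.exists_eq_add_of_le' hm
  rw [show b + 2 - 1 = b + 1 by omega, show b + 2 - 2 = b by omega, c_eq, c_eq, c_eq,
    ww_succ (b + 1), ww_succ b]
  have h := SS_rec b
  push_cast
  linear_combination (2 * (2 * ((b : ℚ) + 1) + 1) * (2 * (2 * b + 1) * ww b)) * h
end
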